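/- Let R be a φ-ring (a commutative ring whose nilradical Nil(R) is a divided prime ideal). Then R is a φ-Prüfer ring (equivalently, R/Nil(R) is a Prüfer domain) if and only if c(fg) = c(f)·c(g) for all non-nilpotent polynomials f, g ∈ R[X], where c(h) denotes the content of h (the ideal of R generated by the coefficients of h). -/

import Mathlib

/-- A φ-ring: a commutative ring whose nilradical is a divided prime ideal
(prime and comparable under inclusion with every ideal). -/
def IsPhiRing (R : Type*) [CommRing R] : Prop :=
  (nilradical R).IsPrime ∧ ∀ I : Ideal R, I ≤ nilradical R ∨ nilradical R ≤ I

/-- A φ-Prüfer ring: `R ⧸ nilradical R` is a Prüfer domain, i.e., every nonzero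
finitely generated ideal of it is invertible as a fractional ideal. -/
def IsPhiPrufer (R : Type*) [CommRing R] : Prop :=
  ∀ I : Ideal (R ⧸ nilradical R), I ≠ ⊥ → I.FG →
    ∃ J : FractionalIdeal (nonZeroDivisors (R ⧸ nilradical R))
        (FractionRing (R ⧸ nilradical R)),
      (I : FractionalIdeal (nonZeroDivisors (R ⧸ nilradical R))
        (FractionRing (R ⧸ nilradical R))) * J = 1

/-- The content ideal of a polynomial: the ideal generated by its coefficients. -/
def contentIdeal {R : Type*} [CommRing R] (f : Polynomial R) : Ideal R :=
  Ideal.span (Set.range f.coeff)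

theorem contentIdeal_eq_polynomial_contentIdeal {R : Type*} [CommRing R] (f : Polynomial R) :
    contentIdeal f = f.contentIdeal := by
  apply le_antisymm
  · rw [contentIdeal, Ideal.span_le]
    rintro _ ⟨n, rfl⟩
    exact f.coeff_mem_contentIdeal n
  · rw [Polynomial.contentIdeal_def, Ideal.span_le]
    intro x hx
    obtain ⟨n, -, rfl⟩ := Polynomial.mem_coeffs_iff.mp hx
    exact Ideal.subset_span ⟨n, rfl⟩

/-- An ideal is locally principal if it becomes principal, generated by one of its elements, after
inverting some element outside any given maximal ideal. -/
def Ideal.IsLocallyPrincipal {D : Type*} [CommRing D] (I : Ideal D) : Prop :=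
  ∀ m : Ideal D, m.IsMaximal → ∃ a ∈ I, ∃ u ∉ m, ∀ x ∈ I, a ∣ u * x

section Domain

open nonZeroDivisors

variable {D : Type*} [CommRing D]

theorem Ideal.IsLocallyPrincipal.of_coe_mul_eq_one {K : Type*} [Field K] [Algebra D K]
    [IsFractionRing D K] {I : Ideal D} {J : FractionalIdeal D⁰ K}
    (h : (I : FractionalIdeal D⁰ K) * J = 1) : I.IsLocallyPrincipal := by
  intro m hm
  have mul_mem : ∀ x ∈ I, ∀ b ∈ J, ∃ t, algebraMap D K t = algebraMap D K x * b := by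
    intro x hx b hb
    have := FractionalIdeal.mul_mem_mul (FractionalIdeal.mem_coeIdeal_of_mem D⁰ hx) hb
    rw [h] at this
    exact (FractionalIdeal.mem_one_iff D⁰).mp this
  have key : ∃ a ∈ I, ∃ b ∈ J, ∃ u ∉ m, algebraMap D K u = algebraMap D K a * b := by
    by_contra! hc
    have hle : (I : FractionalIdeal D⁰ K) * J ≤ (m : FractionalIdeal D⁰ K) := by
      rw [FractionalIdeal.mul_le]
      intro i hi b hb
      obtain ⟨a, ha, rfl⟩ := (FractionalIdeal.mem_coeIdeal D⁰).mp hi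
      obtain ⟨t, ht⟩ := mul_mem a ha b hb
      rw [← ht]
      refine FractionalIdeal.mem_coeIdeal_of_mem D⁰ ?_
      by_contra htm
      exact hc a ha b hb t htm ht
    rw [h, ← FractionalIdeal.coeIdeal_top, FractionalIdeal.coeIdeal_le_coeIdeal] at hle
    exact hm.ne_top (top_le_iff.mp hle)
  obtain ⟨a, ha, b, hb, u, hu, hab⟩ := key
  refine ⟨a, ha, u, hu, fun x hx ↦ ?_⟩
  obtain ⟨t, ht⟩ := mul_mem x hx b hb
  refine ⟨t, IsFractionRing.injective D K ?_⟩
  rw [map_mul, map_mul, hab, ht]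
  ring

theorem Ideal.IsLocallyPrincipal.exists_mul_eq_span_singleton [IsDomain D] {I : Ideal D}
    (hI : I.IsLocallyPrincipal) {d : D} (hd : d ∈ I) :
    ∃ J : Ideal D, I * J = Ideal.span {d} := by
  refine ⟨(Ideal.span {d}).colon (I : Set D), le_antisymm ?_ ?_⟩
  · rw [Ideal.mul_le]
    intro x hx y hy
    rw [mul_comm]
    exact Submodule.mem_colon.mp hy x hx
  · set J := (Ideal.span {d}).colon (I : Set D)
    suffices h : (I * J).colon ({d} : Set D) = ⊤ by
      rw [Ideal.span_singleton_le_iff_mem]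
      have h1 : (1 : D) ∈ (I * J).colon ({d} : Set D) := h ▸ Submodule.mem_top
      simpa using Submodule.mem_colon.mp h1 d rfl
    by_contra hne
    obtain ⟨m, hm, hle⟩ := Ideal.exists_le_maximal _ hne
    obtain ⟨a, ha, u, hu, hdvd⟩ := hI m hm
    obtain ⟨t, ht⟩ := hdvd d hd
    have hu0 : u ≠ 0 := fun h ↦ hu (h ▸ m.zero_mem)
    refine hu (hle (Submodule.mem_colon.mpr ?_))
    rintro _ rfl
    rw [smul_eq_mul, ht]
    refine Ideal.mul_mem_mul ha (Submodule.mem_colon.mpr fun x hx ↦ ?_)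
    obtain ⟨s, hs⟩ := hdvd x hx
    refine Ideal.mem_span_singleton.mpr ⟨s, mul_left_cancel₀ hu0 ?_⟩
    rw [smul_eq_mul]
    linear_combination t * hs - s * ht

theorem FractionalIdeal.exists_mul_eq_one_of_mul_eq_span_singleton (K : Type*) [Field K]
    [Algebra D K] [IsFractionRing D K] {I J : Ideal D} {d : D} (hd : d ≠ 0)
    (h : I * J = Ideal.span {d}) :
    ∃ J' : FractionalIdeal D⁰ K, (I : FractionalIdeal D⁰ K) * J' = 1 := by
  have hd' : algebraMap D K d ≠ 0 := by simpa using hd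
  refine ⟨J * FractionalIdeal.spanSingleton D⁰ (algebraMap D K d)⁻¹, ?_⟩
  rw [← mul_assoc, ← FractionalIdeal.coeIdeal_mul, h, FractionalIdeal.coeIdeal_span_singleton,
    FractionalIdeal.spanSingleton_mul_spanSingleton, mul_inv_cancel₀ hd',
    FractionalIdeal.spanSingleton_one]

theorem Ideal.isLocallyPrincipal_span_singleton (a : D) :
    (Ideal.span {a}).IsLocallyPrincipal := fun m hm ↦
  ⟨a, Ideal.mem_span_singleton_self a, 1, (Ideal.ne_top_iff_one m).mp hm.ne_top,
    fun x hx ↦ by simpa using Ideal.mem_span_singleton.mp hx⟩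

theorem Polynomial.contentIdeal_C_mul {R : Type*} [CommRing R] (c : R) (f : Polynomial R) :
    (C c * f).contentIdeal = Ideal.span {c} * f.contentIdeal := by
  apply le_antisymm
  · simpa using contentIdeal_mul_le_mul_contentIdeal (C c) f
  · rw [contentIdeal_def f, Ideal.span_mul_span', Ideal.span_le]
    rintro _ ⟨e, he, x, hx, rfl⟩
    obtain rfl : e = c := he
    obtain ⟨n, -, rfl⟩ := mem_coeffs_iff.mp hx
    simpa using coeff_mem_contentIdeal (C e * f) n

theorem Polynomial.exists_C_mul_eq_of_isLocallyPrincipal [IsDomain D] {f : Polynomial D}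
    (hf : f ≠ 0) (h : f.contentIdeal.IsLocallyPrincipal) {m : Ideal D} (hm : m.IsMaximal) :
    ∃ a : D, ∃ u ∉ m, ∃ p : Polynomial D, C u * f = C a * p ∧ ¬p.contentIdeal ≤ m := by
  obtain ⟨a, ha, u, hu, hdvd⟩ := h m hm
  have hdvd' : C a ∣ C u * f := by
    rw [C_dvd_iff_dvd_coeff]
    intro i
    rw [coeff_C_mul]
    exact hdvd _ (f.coeff_mem_contentIdeal i)
  obtain ⟨p, hp⟩ := hdvd'
  refine ⟨a, u, hu, p, hp, fun hpm ↦ hu ?_⟩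
  have hu0 : u ≠ 0 := fun h ↦ hu (h ▸ m.zero_mem)
  have ha0 : a ≠ 0 := by
    rintro rfl
    rw [C_0, zero_mul] at hp
    exact mul_ne_zero (C_ne_zero.mpr hu0) hf hp
  have key : u * a ∈ Ideal.span {a} * m := by
    have := Ideal.mul_mem_mul (Ideal.mem_span_singleton_self u) ha
    rw [← contentIdeal_C_mul, hp, contentIdeal_C_mul] at this
    exact Ideal.mul_mono_right hpm this
  obtain ⟨z, hz, hza⟩ := Ideal.mem_span_singleton_mul.mp key
  rw [mul_comm u a] at hza
  exact mul_left_cancel₀ ha0 hza ▸ hz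

theorem Polynomial.contentIdeal_mul_of_isLocallyPrincipal [IsDomain D] {f g : Polynomial D}
    (hf : f.contentIdeal.IsLocallyPrincipal) (hg : g.contentIdeal.IsLocallyPrincipal) :
    (f * g).contentIdeal = f.contentIdeal * g.contentIdeal := by
  rcases eq_or_ne f 0 with rfl | hf0
  · simp
  rcases eq_or_ne g 0 with rfl | hg0
  · simp
  refine le_antisymm (contentIdeal_mul_le_mul_contentIdeal f g) ?_
  refine (Submodule.colon_eq_top_iff_subset _).mp ?_
  by_contra hne
  obtain ⟨m, hm, hle⟩ := Ideal.exists_le_maximal _ hne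
  obtain ⟨a, u, hu, p, hp, hpm⟩ := exists_C_mul_eq_of_isLocallyPrincipal hf0 hf hm
  obtain ⟨b, v, hv, q, hq, hqm⟩ := exists_C_mul_eq_of_isLocallyPrincipal hg0 hg hm
  have hpq : ¬(p * q).contentIdeal ≤ m := fun h ↦ by
    have := mul_contentIdeal_le_radical_contentIdeal_mul.trans
      ((Ideal.radical_mono h).trans hm.isPrime.isRadical)
    exact (hm.isPrime.mul_le.mp this).elim hpm hqm
  have hsmul : Ideal.span {u * v} * (f.contentIdeal * g.contentIdeal) =
      Ideal.span {a * b} * (p.contentIdeal * q.contentIdeal) := by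
    rw [← Ideal.span_singleton_mul_span_singleton, ← Ideal.span_singleton_mul_span_singleton,
      mul_mul_mul_comm, ← contentIdeal_C_mul, ← contentIdeal_C_mul, hp, hq, contentIdeal_C_mul,
      contentIdeal_C_mul, mul_mul_mul_comm]
  have hprod : Ideal.span {u * v} * (f * g).contentIdeal =
      Ideal.span {a * b} * (p * q).contentIdeal := by
    rw [← contentIdeal_C_mul, ← contentIdeal_C_mul, C_mul, C_mul, mul_mul_mul_comm, hp, hq,
      mul_mul_mul_comm]
  obtain ⟨w, hw, hwm⟩ := SetLike.not_le_iff_exists.mp hpq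
  have huvw : u * v * w ∉ m := fun h ↦
    (hm.isPrime.mem_or_mem h).elim (fun h ↦ (hm.isPrime.mem_or_mem h).elim hu hv) hwm
  refine huvw (hle (Submodule.mem_colon.mpr fun x hx ↦ ?_))
  have hx' : u * v * x ∈ Ideal.span {a * b} := by
    have hmem : u * v * x ∈ Ideal.span {u * v} * (f.contentIdeal * g.contentIdeal) :=
      Ideal.mul_mem_mul (Ideal.mem_span_singleton_self (u * v)) hx
    rw [hsmul] at hmem
    exact Ideal.mul_le_left hmem
  obtain ⟨s, hs⟩ := Ideal.mem_span_singleton.mp hx'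
  have hab : a * b * w ∈ (f * g).contentIdeal := by
    have hmem : a * b * w ∈ Ideal.span {a * b} * (p * q).contentIdeal :=
      Ideal.mul_mem_mul (Ideal.mem_span_singleton_self (a * b)) hw
    rw [← hprod] at hmem
    exact Ideal.mul_le_right hmem
  rw [smul_eq_mul, show u * v * w * x = s * (a * b * w) by linear_combination w * hs]
  exact Ideal.mul_mem_left _ _ hab

open Polynomial in
theorem Ideal.isLocallyPrincipal_span_pair_of_contentIdeal_mul [IsDomain D]
    (h : ∀ f g : Polynomial D, f ≠ 0 → g ≠ 0 →
      (f * g).contentIdeal = f.contentIdeal * g.contentIdeal) (a b : D) :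
    (Ideal.span {a, b}).IsLocallyPrincipal := by
  rcases eq_or_ne a 0 with rfl | ha
  · simpa using Ideal.isLocallyPrincipal_span_singleton b
  rcases eq_or_ne b 0 with rfl | hb
  · simpa [Set.pair_comm] using Ideal.isLocallyPrincipal_span_singleton a
  have hmem : ∀ c d : D, c ∈ (C c * X + C d : D[X]).contentIdeal ∧
      d ∈ (C c * X + C d : D[X]).contentIdeal := fun c d ↦
    ⟨by convert coeff_mem_contentIdeal (C c * X + C d : D[X]) 1 using 1; simp [coeff_C],
      by convert coeff_mem_contentIdeal (C c * X + C d : D[X]) 0 using 1; simp⟩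
  have hle : ∀ c d : D, (C c * X + C d : D[X]).contentIdeal ≤ Ideal.span {c, d} := fun c d ↦ by
    rw [contentIdeal_def, Ideal.span_le]
    intro x hx
    obtain ⟨n, -, rfl⟩ := mem_coeffs_iff.mp hx
    rcases n with _ | _ | n
    · simpa using Ideal.subset_span (by simp)
    · simpa using Ideal.subset_span (by simp)
    · simp
  have hlin : ∀ c d : D, (C c * X + C d : D[X]).contentIdeal = Ideal.span {c, d} := fun c d ↦ by
    refine le_antisymm (hle c d) (Ideal.span_le.mpr ?_)
    rintro x (rfl | rfl)
    exacts [(hmem _ _).1, (hmem _ _).2]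
  have hlin0 : ∀ c d : D, c ≠ 0 ∨ d ≠ 0 → (C c * X + C d : D[X]) ≠ 0 := fun c d hcd h0 ↦ by
    have h1 := congrArg (coeff · 1) h0
    have h2 := congrArg (coeff · 0) h0
    simp only [coeff_add, coeff_C_mul_X, coeff_C, coeff_zero] at h1 h2
    simp_all
  have hab : a * b ∈ Ideal.span {a ^ 2, b ^ 2} := by
    have hmul : ((C a * X + C b) * (C a * X + C (-b)) : D[X]) =
        C (a ^ 2) * X ^ 2 + C (-b ^ 2) := by
      simp only [map_neg, map_pow]
      ring
    have hcont := h _ _ (hlin0 a b (.inl ha)) (hlin0 a (-b) (.inl ha))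
    have hprod := Ideal.mul_mem_mul (hmem a b).2 (hmem a (-b)).1
    rw [← hcont, hmul, mul_comm b a] at hprod
    refine (?_ : Polynomial.contentIdeal _ ≤ _) hprod
    rw [contentIdeal_def, Ideal.span_le]
    intro x hx
    obtain ⟨n, -, rfl⟩ := mem_coeffs_iff.mp hx
    rw [coeff_add, coeff_C_mul, coeff_X_pow, coeff_C]
    refine add_mem (Ideal.mul_mem_right _ _ (Ideal.subset_span (by simp))) ?_
    split_ifs
    · exact neg_mem (Ideal.subset_span (by simp))
    · exact zero_mem _
  obtain ⟨x, y, hxy⟩ := Ideal.mem_span_pair.mp hab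
  have hne : y * b ≠ 0 ∨ x * a ≠ 0 := by
    by_contra! hc
    refine mul_ne_zero ha hb ?_
    linear_combination -hxy + a * hc.2 + b * hc.1
  have hcont := h _ _ (hlin0 a b (.inl ha)) (hlin0 _ _ hne)
  have hmul : ((C a * X + C b) * (C (y * b) * X + C (x * a)) : D[X]) =
      C (a * b) * (C y * X ^ 2 + X + C x) := by
    have := congrArg (C : D → D[X]) hxy
    simp only [map_add, map_mul, map_pow] at this ⊢
    linear_combination X * this
  have htop : (C y * X ^ 2 + X + C x : D[X]).contentIdeal = ⊤ := by
    rw [Ideal.eq_top_iff_one]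
    convert coeff_mem_contentIdeal (C y * X ^ 2 + X + C x : D[X]) 1 using 1
    simp [coeff_X]
  rw [hmul, contentIdeal_C_mul, htop, Ideal.mul_top, hlin, hlin] at hcont
  obtain ⟨J, hJ⟩ := FractionalIdeal.exists_mul_eq_one_of_mul_eq_span_singleton (FractionRing D)
    (mul_ne_zero ha hb) hcont.symm
  exact .of_coe_mul_eq_one hJ

theorem Ideal.IsLocallyPrincipal.of_fg
    (h : ∀ a b : D, (Ideal.span {a, b}).IsLocallyPrincipal) {I : Ideal D} (hI : I.FG) :
    I.IsLocallyPrincipal := by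
  induction I, hI using Submodule.fg_induction with
  | singleton a => exact Ideal.isLocallyPrincipal_span_singleton a
  | sup A B _ _ hA hB =>
    intro m hm
    obtain ⟨a, ha, u, hu, hua⟩ := hA m hm
    obtain ⟨b, hb, v, hv, hvb⟩ := hB m hm
    obtain ⟨c, hc, w, hw, hwc⟩ := h a b m hm
    refine ⟨c, ?_, u * v * w, fun h ↦ (hm.isPrime.mem_or_mem h).elim
      (fun h ↦ (hm.isPrime.mem_or_mem h).elim hu hv) hw, fun x hx ↦ ?_⟩
    · refine Ideal.span_le.mpr ?_ hc
      rintro x (rfl | rfl)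
      exacts [Ideal.mem_sup_left ha, Ideal.mem_sup_right hb]
    · obtain ⟨y, hy, z, hz, rfl⟩ := Submodule.mem_sup.mp hx
      obtain ⟨s, hs⟩ := hua y hy
      obtain ⟨t, ht⟩ := hvb z hz
      obtain ⟨a', ha'⟩ := hwc a (Ideal.subset_span (by simp))
      obtain ⟨b', hb'⟩ := hwc b (Ideal.subset_span (by simp))
      exact ⟨a' * s * v + b' * t * u, by
        linear_combination v * w * hs + u * w * ht + v * s * ha' + u * t * hb'⟩

end Domain

theorem phiPrufer_iff_content_mul_of_nonnilpotent (R : Type*) [CommRing R]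
    (hR : IsPhiRing R) :
    IsPhiPrufer R ↔
      ∀ f g : Polynomial R, ¬IsNilpotent f → ¬IsNilpotent g →
        contentIdeal (f * g) = contentIdeal f * contentIdeal g := by
  obtain ⟨hprime, hdiv⟩ := hR
  simp only [contentIdeal_eq_polynomial_contentIdeal]
  set π := Ideal.Quotient.mk (nilradical R)
  have hnil : ∀ f : Polynomial R, f.map π = 0 ↔ IsNilpotent f := fun f ↦ by
    rw [Polynomial.isNilpotent_iff, Polynomial.ext_iff]
    simp [π, Ideal.Quotient.eq_zero_iff_mem, mem_nilradical]
  constructor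
  · intro hP f g hf hg
    have hLP : ∀ p : Polynomial (R ⧸ nilradical R), p ≠ 0 →
        p.contentIdeal.IsLocallyPrincipal := fun p hp ↦ by
      obtain ⟨J, hJ⟩ := hP p.contentIdeal (by simpa using hp) p.contentIdeal_FG
      exact Ideal.IsLocallyPrincipal.of_coe_mul_eq_one hJ
    rw [← hnil] at hf hg
    have hmap : ((f * g).contentIdeal).map π = (f.contentIdeal * g.contentIdeal).map π := by
      rw [Ideal.map_mul, ← Polynomial.contentIdeal_map_eq_map_contentIdeal,
        ← Polynomial.contentIdeal_map_eq_map_contentIdeal,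
        ← Polynomial.contentIdeal_map_eq_map_contentIdeal, Polynomial.map_mul]
      exact Polynomial.contentIdeal_mul_of_isLocallyPrincipal (hLP _ hf) (hLP _ hg)
    have hnle : ¬(f * g).contentIdeal ≤ nilradical R := fun h ↦ by
      rw [← Ideal.mk_ker (I := nilradical R), ← Ideal.map_eq_bot_iff_le_ker,
        ← Polynomial.contentIdeal_map_eq_map_contentIdeal, Polynomial.contentIdeal_eq_bot_iff,
        Polynomial.map_mul] at h
      exact mul_ne_zero hf hg h
    have hle := (hdiv _).resolve_left hnle
    refine le_antisymm (Polynomial.contentIdeal_mul_le_mul_contentIdeal f g) ?_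
    have := Ideal.map_le_iff_le_comap.mp hmap.ge
    rwa [Ideal.comap_map_of_surjective' π Ideal.Quotient.mk_surjective, Ideal.mk_ker,
      sup_eq_left.mpr hle] at this
  · intro h I hI hfg
    have hD : ∀ f g : Polynomial (R ⧸ nilradical R), f ≠ 0 → g ≠ 0 →
        (f * g).contentIdeal = f.contentIdeal * g.contentIdeal := by
      intro f g hf hg
      obtain ⟨f, rfl⟩ := Polynomial.map_surjective π Ideal.Quotient.mk_surjective f
      obtain ⟨g, rfl⟩ := Polynomial.map_surjective π Ideal.Quotient.mk_surjective g
      rw [Ne, hnil] at hf hg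
      rw [← Polynomial.map_mul, Polynomial.contentIdeal_map_eq_map_contentIdeal, h f g hf hg,
        Ideal.map_mul, Polynomial.contentIdeal_map_eq_map_contentIdeal,
        Polynomial.contentIdeal_map_eq_map_contentIdeal]
    obtain ⟨d, hd, hd0⟩ := Submodule.exists_mem_ne_zero_of_ne_bot hI
    obtain ⟨J, hJ⟩ := (Ideal.IsLocallyPrincipal.of_fg
      (Ideal.isLocallyPrincipal_span_pair_of_contentIdeal_mul hD)
      hfg).exists_mul_eq_span_singleton hd
    exact FractionalIdeal.exists_mul_eq_one_of_mul_eq_span_singleton _ hd0 hJ
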